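/- The series ∑_{n=0}^∞ ((1/2)_n)^3/((1)_n^3) · (6n+1) · (-1/8)^n equals 2√2/π. -/

import Mathlib

open Real

noncomputable def poch (a : ℝ) (n : ℕ) : ℝ := (ascPochhammer ℝ n).eval a

open Filter Topology

lemma poch_zero' (a : ℝ) : poch a 0 = 1 := by simp [poch]

lemma poch_succ' (a : ℝ) (n : ℕ) : poch a (n+1) = poch a n * (a + n) := by
  simp [poch, ascPochhammer_succ_eval]

lemma poch_pos' (a : ℝ) (ha : 0 < a) (n : ℕ) : 0 < poch a n := by
  induction n with
  | zero => simp [poch_zero']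
  | succ n ih => rw [poch_succ']; positivity

noncomputable def cA (j : ℕ) : ℝ :=
  (poch (1/2) j * poch (1/2) j * poch (1/2) j) / (poch 1 j)^3

lemma cA_zero : cA 0 = 1 := by simp [cA, poch_zero']

lemma cA_succ (j : ℕ) : cA (j+1) = cA j * ((j + 1/2)^3 / (j+1)^3) := by
  have h := (poch_pos' 1 one_pos j).ne'
  have h2 : (j:ℝ) + 1 ≠ 0 := by positivity
  have h3 : (1:ℝ) + j ≠ 0 := by positivity
  unfold cA
  rw [poch_succ', poch_succ', add_comm (1:ℝ) j]
  field_simp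
  ring

lemma cA_nonneg (j : ℕ) : 0 ≤ cA j := by
  have h := poch_pos' 1 one_pos j
  have h' := poch_pos' (1/2) (by norm_num) j
  unfold cA; positivity

lemma cA_le (j : ℕ) : cA j ≤ 1 := by
  induction j with
  | zero => simp [cA_zero]
  | succ j ih =>
    rw [cA_succ]
    have : ((j:ℝ) + 1/2)^3 / (j+1)^3 ≤ 1 := by
      rw [div_le_one (by positivity)]
      gcongr
      norm_num
    exact mul_le_one₀ ih (by positivity) this

noncomputable def wW (N j : ℕ) : ℝ :=
  ∏ i ∈ Finset.range j, (((i:ℝ) - N) / (2*N + 3/2 + i))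

lemma wW_succ (N j : ℕ) : wW N (j+1) = wW N j * (((j:ℝ) - N) / (2*N + 3/2 + j)) := by
  unfold wW; rw [Finset.prod_range_succ]

lemma wW_abs (N j : ℕ) : |wW N j| ≤ 1 := by
  unfold wW
  rw [Finset.abs_prod]
  apply Finset.prod_le_one
  · intros; positivity
  · intro i _
    have hN : (0:ℝ) ≤ N := by positivity
    have hi : (0:ℝ) ≤ i := by positivity
    rw [abs_div, abs_of_pos (show (0:ℝ) < 2*N + 3/2 + i by positivity),
      div_le_one (by positivity), abs_le]
    constructor <;> linarith

lemma wW_zero (N j : ℕ) (h : N < j) : wW N j = 0 := by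
  unfold wW
  exact Finset.prod_eq_zero (Finset.mem_range.2 h) (by simp)

lemma wW_shift (N J : ℕ) :
    wW (N+1) (J+1) = -(N+1) * (2*N+3/2) * (2*N+5/2) * wW N J /
      ((2*N+3/2+J) * (2*N+5/2+J) * (2*N+7/2+J)) := by
  induction J with
  | zero =>
    simp [wW]
    field_simp
    ring
  | succ J ih =>
    rw [wW_succ, ih, wW_succ N J]
    push_cast
    have h1 : (2*(N:ℝ)+3/2+J) ≠ 0 := by positivity
    have h2 : (2*(N:ℝ)+5/2+J) ≠ 0 := by positivity
    have h3 : (2*(N:ℝ)+7/2+J) ≠ 0 := by positivity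
    have h4 : (2*(N:ℝ)+9/2+J) ≠ 0 := by positivity
    rw [show 2*((N:ℝ)+1)+3/2+(J+1) = 2*N+9/2+J by ring,
      show 2*(N:ℝ)+3/2+(J+1) = 2*N+5/2+J by ring,
      show 2*(N:ℝ)+5/2+(J+1) = 2*N+7/2+J by ring,
      show 2*(N:ℝ)+7/2+(J+1) = 2*N+9/2+J by ring]
    rw [div_mul_div_comm, mul_div_assoc', mul_div_assoc', div_div,
      div_eq_div_iff (by positivity) (by positivity)]
    ring

noncomputable def tT (N j : ℕ) : ℝ := cA j * (6*(j:ℝ)+1) * (1/4)^j * wW N j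

lemma wz (N J : ℕ) :
    ∑ j ∈ Finset.range (J+1), (tT (N+1) j - (N+3/4)*(N+5/4)/(N+1)^2 * tT N j) =
      cA J * (1/4)^J * wW N J * ((J+1/2)^3 * (4*N+3) * (4*N+5)) /
        (8 * (N+1)^2 * (2*N+3/2+J) * (2*N+5/2+J)) := by
  induction J with
  | zero =>
    simp [tT, wW, cA_zero]
    have h1 : (2*(N:ℝ)+3/2) ≠ 0 := by positivity
    have h2 : (2*(N:ℝ)+5/2) ≠ 0 := by positivity
    have h3 : (N:ℝ)+1 ≠ 0 := by positivity
    field_simp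
    ring
  | succ J ih =>
    rw [Finset.sum_range_succ, ih]
    unfold tT
    rw [wW_shift, wW_succ, cA_succ]
    push_cast
    have h0 : (N:ℝ)+1 ≠ 0 := by positivity
    have hj : (J:ℝ)+1 ≠ 0 := by positivity
    have h1 : (2*(N:ℝ)+3/2+J) ≠ 0 := by positivity
    have h2 : (2*(N:ℝ)+5/2+J) ≠ 0 := by positivity
    have h3 : (2*(N:ℝ)+7/2+J) ≠ 0 := by positivity
    rw [show 2*(N:ℝ)+3/2+(J+1) = 2*N+5/2+J by ring,
      show 2*(N:ℝ)+5/2+(J+1) = 2*N+7/2+J by ring, pow_succ (1/4:ℝ) J]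
    generalize (1/4:ℝ)^J = p
    generalize cA J = c
    generalize wW N J = w
    generalize ha : 2*(N:ℝ)+3/2+J = a at *
    have hb : 2*(N:ℝ)+5/2+J = a + 1 := by rw [← ha]; ring
    have hc : 2*(N:ℝ)+7/2+J = a + 2 := by rw [← ha]; ring
    rw [hb] at h2 ⊢
    rw [hc] at h3 ⊢
    have hJ : (J:ℝ) = a - 2*N - 3/2 := by rw [← ha]; ring
    generalize (J:ℝ) = x at *
    field_simp
    subst hJ
    ring

noncomputable def rR (N : ℕ) : ℝ := poch (3/4) N * poch (5/4) N / (poch 1 N)^2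

lemma sum_tT (N : ℕ) : ∀ M, N < M → ∑ j ∈ Finset.range M, tT N j = rR N := by
  have ext : ∀ N M, N < M → ∑ j ∈ Finset.range M, tT N j = ∑ j ∈ Finset.range (N+1), tT N j := by
    intro N M h
    symm
    apply Finset.sum_subset
    · intro x; simp; omega
    · intro x _ hx
      simp at hx
      simp [tT, wW_zero N x (by omega)]
  induction N with
  | zero =>
    intro M h
    rw [ext 0 M h]
    simp [tT, wW, cA_zero, rR, poch_zero']
  | succ N ih =>
    intro M h
    rw [ext _ M h]
    have := wz N (N+1)
    rw [wW_zero N (N+1) (by omega), Finset.sum_sub_distrib, ← Finset.mul_sum,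
      ih _ (by omega)] at this
    have h2 := (poch_pos' 1 one_pos N).ne'
    have h3 : (N:ℝ)+1 ≠ 0 := by positivity
    simp only [mul_zero, zero_mul, zero_div] at this
    rw [sub_eq_zero.1 this]
    unfold rR
    rw [poch_succ', poch_succ', poch_succ', add_comm (1:ℝ) N]
    field_simp
    ring

lemma prod_poch (a : ℝ) (n : ℕ) : ∏ j ∈ Finset.range n, (a + j) = poch a n := by
  induction n with
  | zero => simp [poch_zero']
  | succ n ih => rw [Finset.prod_range_succ, ih, poch_succ']

lemma poch_one' (n : ℕ) : poch 1 n = (n.factorial : ℝ) := by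
  simp [poch]

lemma poch_quarter (n : ℕ) : poch (1/4) (n+1) = 1/4 * poch (5/4) n := by
  induction n with
  | zero => simp [poch_succ', poch_zero']
  | succ n ih => rw [poch_succ', ih, poch_succ']; push_cast; ring

lemma rR_eq (N : ℕ) (hN : 0 < N) :
    rR N = 4 * ((N:ℝ) / (N + 3/4)) / (GammaSeq (1/4) N * GammaSeq (3/4) N) := by
  have h1 := (poch_pos' 1 one_pos N).ne'
  have h2 := (poch_pos' (3/4) (by norm_num) N).ne'
  have h3 := (poch_pos' (5/4) (by norm_num) N).ne'
  have hN' : (0:ℝ) < N := by exact_mod_cast hN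
  have h4 : (N:ℝ) + 3/4 ≠ 0 := by positivity
  have hp : (N:ℝ)^(1/4:ℝ) * (N:ℝ)^(3/4:ℝ) = N := by
    rw [← Real.rpow_add hN']; norm_num
  have hG : GammaSeq (1/4) N * GammaSeq (3/4) N =
      N * (poch 1 N)^2 / (1/4 * poch (5/4) N * (poch (3/4) N * (N + 3/4))) := by
    unfold GammaSeq
    rw [prod_poch, prod_poch, poch_quarter, poch_succ', ← poch_one', div_mul_div_comm,
      add_comm (3/4:ℝ) N]
    congr 1
    linear_combination (poch 1 N)^2 * hp
  rw [hG, rR]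
  field_simp

lemma rR_tendsto : Tendsto rR atTop (𝓝 (2 * Real.sqrt 2 / π)) := by
  have hG : Gamma (1/4) * Gamma (3/4) = π / (Real.sqrt 2 / 2) := by
    have := Real.Gamma_mul_Gamma_one_sub (1/4)
    rw [show (1:ℝ) - 1/4 = 3/4 by norm_num, show π * (1/4) = π/4 by ring, Real.sin_pi_div_four] at this
    exact this
  have hne : Gamma (1/4) * Gamma (3/4) ≠ 0 :=
    (mul_pos (Gamma_pos_of_pos (by norm_num)) (Gamma_pos_of_pos (by norm_num))).ne'
  have hl : Tendsto (fun N : ℕ => (N:ℝ) / (N + 3/4)) atTop (𝓝 1) :=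
    tendsto_natCast_div_add_atTop (3/4:ℝ)
  have key := (hl.const_mul 4).div
    ((GammaSeq_tendsto_Gamma (1/4)).mul (GammaSeq_tendsto_Gamma (3/4))) hne
  have hval : (4 * 1 / (Gamma (1/4) * Gamma (3/4)) : ℝ) = 2 * Real.sqrt 2 / π := by
    rw [hG]
    field_simp
    norm_num
  rw [hval] at key
  refine key.congr' ?_
  filter_upwards [eventually_gt_atTop 0] with N hN
  rw [rR_eq N hN]
  rfl

lemma wW_tendsto (j : ℕ) : Tendsto (fun N => wW N j) atTop (𝓝 ((-1/2)^j)) := by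
  have hf : ∀ i : ℕ, Tendsto (fun N : ℕ => ((i:ℝ) - N) / (2*N + 3/2 + i)) atTop (𝓝 (-1/2)) := by
    intro i
    have hinv : Tendsto (fun N : ℕ => ((N:ℝ))⁻¹) atTop (𝓝 0) := tendsto_inv_atTop_nhds_zero_nat
    have h1 : Tendsto (fun N : ℕ => ((i:ℝ) * (N:ℝ)⁻¹ - 1) / (2 + (3/2 + i) * (N:ℝ)⁻¹)) atTop
        (𝓝 (((i:ℝ) * 0 - 1) / (2 + (3/2 + i) * 0))) :=
      ((hinv.const_mul _).sub_const 1).div ((hinv.const_mul _).const_add 2) (by norm_num)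
    have e : (((i:ℝ) * 0 - 1) / (2 + (3/2 + i) * 0)) = -1/2 := by norm_num
    rw [e] at h1
    refine h1.congr' ?_
    filter_upwards [eventually_gt_atTop 0] with N hN
    have hN' : (0:ℝ) < N := by exact_mod_cast hN
    have : 2*(N:ℝ) + 3/2 + i ≠ 0 := by positivity
    have : 2 + (3/2 + (i:ℝ)) * (N:ℝ)⁻¹ ≠ 0 := by positivity
    rw [div_eq_div_iff (by assumption) (by assumption)]
    field_simp
    ring
  have := tendsto_finsetProd (Finset.range j) (fun i _ => hf i)
  rw [Finset.prod_const, Finset.card_range] at this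
  exact this

theorem stmt_10 :
    ∑' n : ℕ, (poch (1/2) n * poch (1/2) n * poch (1/2) n) / (poch 1 n)^3 * (6*(n:ℝ)+1) * ((-1:ℝ)/8)^n = 2 * Real.sqrt 2 / π := by
  have hts : ∀ N, ∑' j, tT N j = rR N := by
    intro N
    rw [← sum_tT N (N+1) (by omega)]
    apply tsum_eq_sum
    intro j hj
    simp at hj
    simp [tT, wW_zero N j (by omega)]
  have hsum : Summable (fun j : ℕ => (6*(j:ℝ)+1) * (1/4:ℝ)^j) := by
    have h1 := summable_pow_mul_geometric_of_norm_lt_one 1 (r := (1/4:ℝ)) (by norm_num)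
    have h0 := summable_geometric_of_lt_one (r := (1/4:ℝ)) (by norm_num) (by norm_num)
    refine ((h1.mul_left 6).add h0).congr ?_
    intro j; ring
  have hlim := tendsto_tsum_of_dominated_convergence (𝓕 := atTop) (f := tT)
    (g := fun n => (poch (1/2) n * poch (1/2) n * poch (1/2) n) / (poch 1 n)^3 * (6*(n:ℝ)+1) * ((-1:ℝ)/8)^n)
    hsum ?_ ?_
  · simp only [hts] at hlim
    exact tendsto_nhds_unique hlim rR_tendsto
  · intro j
    have := (wW_tendsto j).const_mul (cA j * (6*(j:ℝ)+1) * (1/4)^j)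
    rw [mul_assoc (cA j * (6*(j:ℝ)+1)), ← mul_pow] at this
    norm_num at this ⊢
    simpa [tT, cA] using this
  · refine Eventually.of_forall fun N j => ?_
    have h6 : (0:ℝ) ≤ 6*(j:ℝ)+1 := by positivity
    unfold tT
    rw [Real.norm_eq_abs, abs_mul, abs_mul, abs_mul, abs_of_nonneg (cA_nonneg j),
      abs_of_nonneg h6, abs_of_nonneg (show (0:ℝ) ≤ (1/4)^j by positivity)]
    calc cA j * (6*(j:ℝ)+1) * (1/4)^j * |wW N j| ≤ 1 * (6*(j:ℝ)+1) * (1/4)^j * 1 := by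
          gcongr
          · exact cA_le j
          · exact wW_abs N j
      _ = _ := by ring
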